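/- Let m(1), …, m(k), n ≥ 1. There exists a morphism (of Boolean inverse ∧-monoids) from the direct product I_{m(1)} × ⋯ × I_{m(k)} of symmetric inverse monoids to the symmetric inverse monoid I_n if and only if there exist non-negative integers s₁, …, s_k such that s₁·m(1) + ⋯ + s_k·m(k) = n. -/

import Mathlib

namespace Coordinatization

/-- The data of a monoid with zero equipped with an inverse operation. -/
structure InvMonData (S : Type) where
  mul : S → S → S
  one : S
  zero : S
  inv : S → S

variable {S T : Type}

/-- `M` is an inverse monoid with zero: a monoid with zero in which every element `a`
has a unique generalized inverse `a⁻¹`. -/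
structure IsInverseMonoid (M : InvMonData S) : Prop where
  mul_assoc : ∀ a b c, M.mul (M.mul a b) c = M.mul a (M.mul b c)
  one_mul : ∀ a, M.mul M.one a = a
  mul_one : ∀ a, M.mul a M.one = a
  zero_mul : ∀ a, M.mul M.zero a = M.zero
  mul_zero : ∀ a, M.mul a M.zero = M.zero
  inv_law₁ : ∀ a, M.mul (M.mul a (M.inv a)) a = a
  inv_law₂ : ∀ a, M.mul (M.mul (M.inv a) a) (M.inv a) = M.inv a
  inv_unique : ∀ a b, M.mul (M.mul a b) a = a → M.mul (M.mul b a) b = b → b = M.inv a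

/-- `e` is an idempotent. -/
def IsIdem (M : InvMonData S) (e : S) : Prop := M.mul e e = e

/-- The natural partial order: `a ≤ b` iff `a = b·e` for some idempotent `e`. -/
def nle (M : InvMonData S) (a b : S) : Prop := ∃ e, IsIdem M e ∧ a = M.mul b e

/-- `a` and `b` are compatible: `a⁻¹b` and `ab⁻¹` are both idempotents. -/
def Compatible (M : InvMonData S) (a b : S) : Prop :=
  IsIdem M (M.mul (M.inv a) b) ∧ IsIdem M (M.mul a (M.inv b))

/-- `a` and `b` are orthogonal: `a⁻¹b = 0 = ab⁻¹`. -/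
def Orthogonal (M : InvMonData S) (a b : S) : Prop :=
  M.mul (M.inv a) b = M.zero ∧ M.mul a (M.inv b) = M.zero

/-- `j` is the join of `a` and `b` with respect to the natural partial order. -/
def IsJoin (M : InvMonData S) (a b j : S) : Prop :=
  nle M a j ∧ nle M b j ∧ ∀ c, nle M a c → nle M b c → nle M j c

/-- `m` is the meet of `a` and `b` with respect to the natural partial order. -/
def IsMeet (M : InvMonData S) (a b m : S) : Prop :=
  nle M m a ∧ nle M m b ∧ ∀ c, nle M c a → nle M c b → nle M c m

/-- Green's relation `D`: `e D f` iff there is `a` with `a⁻¹a = e` and `aa⁻¹ = f`. -/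
def DRel (M : InvMonData S) (e f : S) : Prop :=
  ∃ a, M.mul (M.inv a) a = e ∧ M.mul a (M.inv a) = f

/-- `f` is a Boolean complement of the idempotent `e` in the Boolean algebra of
idempotents: `e·f = 0` and `e ∨ f = 1`. -/
def IsComplPair (M : InvMonData S) (e f : S) : Prop :=
  IsIdem M e ∧ IsIdem M f ∧ M.mul e f = M.zero ∧ IsJoin M e f M.one

/-- A Boolean inverse monoid: an inverse monoid with zero in which the idempotents form a
Boolean algebra under the natural partial order (meets of idempotents are given by products;
complements exist), all compatible binary joins exist, and multiplication distributes over
binary joins. -/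
structure IsBooleanInverseMonoid (M : InvMonData S) : Prop where
  invMon : IsInverseMonoid M
  joins_exist : ∀ a b, Compatible M a b → ∃ j, IsJoin M a b j
  mul_join_left : ∀ c a b j, IsJoin M a b j → IsJoin M (M.mul c a) (M.mul c b) (M.mul c j)
  mul_join_right : ∀ c a b j, IsJoin M a b j → IsJoin M (M.mul a c) (M.mul b c) (M.mul j c)
  compl_exists : ∀ e, IsIdem M e → ∃ f, IsComplPair M e f

/-- The relation `D` preserves complementation: `e D f` implies `ē D f̄`. -/
def DPreservesCompl (M : InvMonData S) : Prop :=
  ∀ e f e' f', DRel M e f → IsComplPair M e e' → IsComplPair M f f' → DRel M e' f'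

/-- `M` is completely semisimple: `e D f ≤ e` implies `e = f` for idempotents. -/
def CompletelySemisimple (M : InvMonData S) : Prop :=
  ∀ e f, IsIdem M e → IsIdem M f → DRel M e f → nle M f e → e = f

/-- A Foulis monoid: a completely semisimple Boolean inverse monoid in which `D`
preserves complementation. -/
def IsFoulis (M : InvMonData S) : Prop :=
  IsBooleanInverseMonoid M ∧ CompletelySemisimple M ∧ DPreservesCompl M

/-- The preorder underlying `S/J`: `Jle s t` iff `SsS ⊆ StS`, i.e. `s = a·t·b` for some `a, b`. -/
def Jle (M : InvMonData S) (s t : S) : Prop := ∃ a b, s = M.mul (M.mul a t) b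

/-- `S/J`, the poset of principal ideals, is a lattice. -/
def LatticeCondition (M : InvMonData S) : Prop :=
  ∀ s t : S,
    (∃ m, Jle M m s ∧ Jle M m t ∧ ∀ c, Jle M c s → Jle M c t → Jle M c m) ∧
    (∃ j, Jle M s j ∧ Jle M t j ∧ ∀ c, Jle M s c → Jle M t c → Jle M j c)

/-- `[e] ⊕ [f] = [g]` in `E(S)/D`: there are orthogonal idempotents `e' D e` and `f' D f`
whose join is `D`-related to `g`. -/
def OplusEq (M : InvMonData S) (e f g : S) : Prop :=
  ∃ e' f' j, IsIdem M e' ∧ IsIdem M f' ∧ DRel M e e' ∧ DRel M f f' ∧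
    M.mul e' f' = M.zero ∧ IsJoin M e' f' j ∧ DRel M j g

/-- `M` is fundamental: only idempotents commute with every idempotent. -/
def Fundamental (M : InvMonData S) : Prop :=
  ∀ s, (∀ e, IsIdem M e → M.mul s e = M.mul e s) → IsIdem M s

/-- `M` is factorizable: every element lies beneath a unit. -/
def Factorizable (M : InvMonData S) : Prop :=
  ∀ s, ∃ g, M.mul g (M.inv g) = M.one ∧ M.mul (M.inv g) g = M.one ∧ nle M s g

/-- All binary meets exist (`∧`-monoid). -/
def HasMeets (M : InvMonData S) : Prop := ∀ a b, ∃ m, IsMeet M a b m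

/-- A morphism of Boolean inverse `∧`-monoids: a monoid homomorphism mapping zero to zero,
preserving binary compatible joins and binary meets. -/
def IsMorphism (M : InvMonData S) (N : InvMonData T) (f : S → T) : Prop :=
  f M.one = N.one ∧ f M.zero = N.zero ∧
  (∀ a b, f (M.mul a b) = N.mul (f a) (f b)) ∧
  (∀ a b j, Compatible M a b → IsJoin M a b j → IsJoin N (f a) (f b) (f j)) ∧
  (∀ a b m, IsMeet M a b m → IsMeet N (f a) (f b) (f m))

end Coordinatization
namespace Coordinatization

/-- The symmetric inverse monoid `Iₙ` of all partial bijections of `Fin n`,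
with composition as multiplication, the identity as `1`, the empty map as `0`,
and the inverse partial bijection as inversion. -/
def symData (n : ℕ) : InvMonData (PEquiv (Fin n) (Fin n)) where
  mul f g := g.trans f
  one := PEquiv.refl (Fin n)
  zero := ⊥
  inv f := f.symm

/-- Direct products of inverse monoids, with componentwise operations. -/
def piData {ι : Type} {β : ι → Type} (Ms : ∀ i, InvMonData (β i)) :
    InvMonData (∀ i, β i) where
  mul f g i := (Ms i).mul (f i) (g i)
  one i := (Ms i).one
  zero i := (Ms i).zero
  inv f i := (Ms i).inv (f i)

/-- A semisimple inverse monoid: the finite direct product `I_{m 0} × ⋯ × I_{m (k-1)}`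
of finite symmetric inverse monoids. -/
def ssData (k : ℕ) (m : Fin k → ℕ) :
    InvMonData (∀ i : Fin k, PEquiv (Fin (m i)) (Fin (m i))) :=
  piData (fun i => symData (m i))

/-- The partial identity `1_A` on a subset `A` of `Fin n`. -/
def pid {n : ℕ} (A : Finset (Fin n)) : PEquiv (Fin n) (Fin n) where
  toFun x := if x ∈ A then some x else none
  invFun x := if x ∈ A then some x else none
  inv a b := by
    by_cases ha : a ∈ A <;> by_cases hb : b ∈ A <;>
      simp_all [Option.mem_def, eq_comm] <;> aesop

end Coordinatization
namespace Coordinatization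

lemma mem_pid {n : ℕ} {A : Finset (Fin n)} {x y : Fin n} : y ∈ pid A x ↔ x ∈ A ∧ y = x := by
  change y ∈ (if x ∈ A then some x else none) ↔ _
  split_ifs with h <;> simp [h, eq_comm]

lemma isIdem_pid {n : ℕ} (A : Finset (Fin n)) : IsIdem (symData n) (pid A) := by
  change (pid A).trans (pid A) = pid A
  ext x y
  simp only [← Option.mem_def, PEquiv.mem_trans, mem_pid]
  aesop

lemma eq_of_mem_of_isIdem {n : ℕ} {e : PEquiv (Fin n) (Fin n)} (he : IsIdem (symData n) e)
    {x y : Fin n} (h : y ∈ e x) : y = x := by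
  change e.trans e = e at he
  have h' := h
  rw [← he, PEquiv.mem_trans] at h'
  obtain ⟨z, hxz, hzy⟩ := h'
  obtain rfl : z = y := Option.mem_unique hxz h
  exact e.inj hzy hxz

lemma nle_symData_iff {n : ℕ} {f g : PEquiv (Fin n) (Fin n)} :
    nle (symData n) f g ↔ f ≤ g := by
  rw [PEquiv.le_def]
  constructor
  · rintro ⟨e, he, rfl⟩ x y h
    obtain ⟨z, hxz, hzy⟩ := (PEquiv.mem_trans e g x y).1 h
    rwa [eq_of_mem_of_isIdem he hxz] at hzy
  · intro h
    refine ⟨pid {x | (f x).isSome}, isIdem_pid _, ?_⟩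
    change f = (pid _).trans g
    ext x y
    simp only [← Option.mem_def, PEquiv.mem_trans, mem_pid, Finset.mem_filter, Finset.mem_univ,
      true_and]
    constructor
    · exact fun hy => ⟨x, ⟨Option.isSome_of_mem hy, rfl⟩, h x y hy⟩
    · rintro ⟨_, ⟨hx, rfl⟩, hy⟩
      obtain ⟨z, hz⟩ := Option.isSome_iff_exists.1 hx
      rwa [Option.mem_unique hy (h _ _ hz)]

section SemisimpleOrder

variable {k : ℕ} {m : Fin k → ℕ}

lemma nle_ssData_iff {f g : ∀ i : Fin k, PEquiv (Fin (m i)) (Fin (m i))} :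
    nle (ssData k m) f g ↔ ∀ i, f i ≤ g i := by
  constructor
  · rintro ⟨e, he, rfl⟩ i
    exact nle_symData_iff.1 ⟨e i, congrFun he i, rfl⟩
  · intro h
    choose e he hfe using fun i => nle_symData_iff.2 (h i)
    exact ⟨e, funext he, funext hfe⟩

/-- Joins in a symmetric inverse monoid are unions of partial bijections. -/
lemma isJoin_symData_iff {n : ℕ} {f g j : PEquiv (Fin n) (Fin n)} :
    IsJoin (symData n) f g j ↔
      f ≤ j ∧ g ≤ j ∧ ∀ x, (j x).isSome → (f x).isSome ∨ (g x).isSome := by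
  simp only [IsJoin, nle_symData_iff]
  refine and_congr_right fun hf => and_congr_right fun hg =>
    ⟨fun h x hx => ?_, fun h c hfc hgc => ?_⟩
  · obtain ⟨y, hy⟩ := Option.isSome_iff_exists.1 hx
    have hle : j ≤ (pid {x | (f x).isSome ∨ (g x).isSome}).trans j := by
      apply h <;> rw [PEquiv.le_def] <;> intro a b hab <;>
        refine (PEquiv.mem_trans _ _ _ _).2 ⟨a, mem_pid.2 ⟨?_, rfl⟩, ?_⟩
      · simp [Option.isSome_of_mem hab]
      · exact PEquiv.le_def.1 hf _ _ hab
      · simp [Option.isSome_of_mem hab]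
      · exact PEquiv.le_def.1 hg _ _ hab
    obtain ⟨z, hz, -⟩ := (PEquiv.mem_trans _ _ _ _).1 (PEquiv.le_def.1 hle x y hy)
    simpa using (mem_pid.1 hz).1
  · rw [PEquiv.le_def] at *
    intro x y hy
    rcases h x (Option.isSome_of_mem hy) with hx | hx <;>
      obtain ⟨z, hz⟩ := Option.isSome_iff_exists.1 hx
    · rw [Option.mem_unique hy (hf x z hz)]
      exact hfc x z hz
    · rw [Option.mem_unique hy (hg x z hz)]
      exact hgc x z hz

lemma isJoin_ssData_iff {f g j : ∀ i : Fin k, PEquiv (Fin (m i)) (Fin (m i))} :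
    IsJoin (ssData k m) f g j ↔ ∀ i, IsJoin (symData (m i)) (f i) (g i) (j i) := by
  simp only [IsJoin, nle_ssData_iff, nle_symData_iff]
  constructor
  · rintro ⟨hf, hg, h⟩ i
    refine ⟨hf i, hg i, fun c hfc hgc => ?_⟩
    have := h (Function.update j i c) (fun l => ?_) (fun l => ?_) i
    · simpa using this
    all_goals
      obtain rfl | hl := eq_or_ne l i
      · simpa
      · simp [hl, hf l, hg l]
  · exact fun h => ⟨fun i => (h i).1, fun i => (h i).2.1,
      fun c hfc hgc i => (h i).2.2 _ (hfc i) (hgc i)⟩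

/-- Meets in a symmetric inverse monoid are intersections of partial bijections. -/
lemma isMeet_symData_iff {n : ℕ} {f g p : PEquiv (Fin n) (Fin n)} :
    IsMeet (symData n) f g p ↔ p ≤ f ∧ p ≤ g ∧ ∀ x y, y ∈ f x → y ∈ g x → y ∈ p x := by
  simp only [IsMeet, nle_symData_iff]
  refine and_congr_right fun _ => and_congr_right fun _ =>
    ⟨fun h x y hf hg => ?_, fun h c hcf hcg => ?_⟩
  · refine PEquiv.le_def.1 (h (PEquiv.single x y) ?_ ?_) x y (PEquiv.mem_single x y) <;>
      rw [PEquiv.le_def] <;> intro a b hab <;>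
      obtain ⟨rfl, rfl⟩ := (PEquiv.mem_single_iff _ _ _ _).1 hab <;> assumption
  · rw [PEquiv.le_def] at *
    exact fun x y hy => h x y (hcf x y hy) (hcg x y hy)

lemma isMeet_ssData_iff {f g p : ∀ i : Fin k, PEquiv (Fin (m i)) (Fin (m i))} :
    IsMeet (ssData k m) f g p ↔ ∀ i, IsMeet (symData (m i)) (f i) (g i) (p i) := by
  simp only [IsMeet, nle_ssData_iff, nle_symData_iff]
  constructor
  · rintro ⟨hf, hg, h⟩ i
    refine ⟨hf i, hg i, fun c hcf hcg => ?_⟩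
    have := h (Function.update p i c) (fun l => ?_) (fun l => ?_) i
    · simpa using this
    all_goals
      obtain rfl | hl := eq_or_ne l i
      · simpa
      · simp [hl, hf l, hg l]
  · exact fun h => ⟨fun i => (h i).1, fun i => (h i).2.1,
      fun c hcf hcg i => (h i).2.2 _ (hcf i) (hcg i)⟩

end SemisimpleOrder

section Existence

variable {k : ℕ} {m : Fin k → ℕ} {n : ℕ} {s : Fin k → ℕ}

/-- The partial function on `Fin n` underlying `copiesMap`. -/
def copiesFun (e : (Σ i, Fin (s i) × Fin (m i)) ≃ Fin n)
    (f : ∀ i : Fin k, PEquiv (Fin (m i)) (Fin (m i))) (x : Fin n) : Option (Fin n) :=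
  (f (e.symm x).1 (e.symm x).2.2).map fun j => e ⟨(e.symm x).1, (e.symm x).2.1, j⟩

lemma copiesFun_apply (e : (Σ i, Fin (s i) × Fin (m i)) ≃ Fin n)
    (f : ∀ i : Fin k, PEquiv (Fin (m i)) (Fin (m i))) (i : Fin k) (a : Fin (s i))
    (j : Fin (m i)) :
    copiesFun e f (e ⟨i, a, j⟩) = (f i j).map fun l => e ⟨i, a, l⟩ := by
  rw [copiesFun, Equiv.symm_apply_apply]

/-- The action of the semisimple inverse monoid on `s i` disjoint copies of each `Fin (m i)`,
transported to `Fin n`. -/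
def copiesMap (e : (Σ i, Fin (s i) × Fin (m i)) ≃ Fin n)
    (f : ∀ i : Fin k, PEquiv (Fin (m i)) (Fin (m i))) : PEquiv (Fin n) (Fin n) where
  toFun := copiesFun e f
  invFun := copiesFun e fun i => (f i).symm
  inv x y := by
    obtain ⟨⟨i, a, j⟩, rfl⟩ := e.surjective x
    obtain ⟨⟨i', a', j'⟩, rfl⟩ := e.surjective y
    simp only [copiesFun_apply, Option.map_eq_some_iff,
      EmbeddingLike.apply_eq_iff_eq]
    constructor <;> rintro ⟨l, hl, h⟩ <;> cases h
    · exact ⟨_, (PEquiv.eq_some_iff _).1 hl, rfl⟩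
    · exact ⟨_, (PEquiv.eq_some_iff _).2 hl, rfl⟩

lemma copiesMap_apply (e : (Σ i, Fin (s i) × Fin (m i)) ≃ Fin n)
    (f : ∀ i : Fin k, PEquiv (Fin (m i)) (Fin (m i))) (i : Fin k) (a : Fin (s i))
    (j : Fin (m i)) :
    copiesMap e f (e ⟨i, a, j⟩) = (f i j).map fun l => e ⟨i, a, l⟩ :=
  copiesFun_apply e f i a j

lemma copiesMap_mono (e : (Σ i, Fin (s i) × Fin (m i)) ≃ Fin n)
    {f g : ∀ i : Fin k, PEquiv (Fin (m i)) (Fin (m i))} (h : ∀ i, f i ≤ g i) :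
    copiesMap e f ≤ copiesMap e g := by
  rw [PEquiv.le_def]
  intro x y
  obtain ⟨⟨i, a, j⟩, rfl⟩ := e.surjective x
  rw [copiesMap_apply, copiesMap_apply]
  simp only [Option.mem_def, Option.map_eq_some_iff]
  exact fun ⟨l, hl, hy⟩ => ⟨l, PEquiv.le_def.1 (h i) j l hl, hy⟩

lemma isMorphism_copiesMap (e : (Σ i, Fin (s i) × Fin (m i)) ≃ Fin n) :
    IsMorphism (ssData k m) (symData n) (copiesMap e) := by
  refine ⟨?_, ?_, fun f g => ?_, fun f g j _ h => ?_, fun f g p h => ?_⟩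
  · refine PEquiv.ext fun x => ?_
    obtain ⟨⟨i, a, j⟩, rfl⟩ := e.surjective x
    rw [copiesMap_apply]
    rfl
  · refine PEquiv.ext fun x => ?_
    obtain ⟨⟨i, a, j⟩, rfl⟩ := e.surjective x
    rw [copiesMap_apply]
    rfl
  · refine PEquiv.ext fun x => ?_
    obtain ⟨⟨i, a, j⟩, rfl⟩ := e.surjective x
    rw [copiesMap_apply]
    change Option.map _ ((g i j).bind (f i)) = (copiesMap e g _).bind (copiesMap e f)
    rw [copiesMap_apply]
    cases g i j with
    | none => rfl
    | some l => exact (copiesMap_apply e f i a l).symm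
  · rw [isJoin_ssData_iff] at h
    simp only [isJoin_symData_iff] at h ⊢
    refine ⟨copiesMap_mono e fun i => (h i).1, copiesMap_mono e fun i => (h i).2.1, fun x => ?_⟩
    obtain ⟨⟨i, a, l⟩, rfl⟩ := e.surjective x
    simpa only [copiesMap_apply, Option.isSome_map] using (h i).2.2 l
  · rw [isMeet_ssData_iff] at h
    simp only [isMeet_symData_iff] at h ⊢
    refine ⟨copiesMap_mono e fun i => (h i).1, copiesMap_mono e fun i => (h i).2.1,
      fun x y => ?_⟩
    obtain ⟨⟨i, a, l⟩, rfl⟩ := e.surjective x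
    simp only [copiesMap_apply, Option.mem_def, Option.map_eq_some_iff]
    rintro ⟨b, hb, rfl⟩ ⟨c, hc, hcb⟩
    simp only [EmbeddingLike.apply_eq_iff_eq, Sigma.mk.injEq, heq_eq_eq, Prod.mk.injEq,
      true_and] at hcb
    subst hcb
    exact ⟨c, (h i).2.2 l c hb hc, rfl⟩

end Existence

section Multiplicity

variable {k : ℕ} {m : Fin k → ℕ} {n : ℕ}

/-- The idempotent of the semisimple inverse monoid attached to a set of points. -/
def ssPid (A : Finset (Σ i, Fin (m i))) (i : Fin k) : PEquiv (Fin (m i)) (Fin (m i)) :=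
  pid {j | ⟨i, j⟩ ∈ A}

lemma mem_ssPid {A : Finset (Σ i, Fin (m i))} {i : Fin k} {x y : Fin (m i)} :
    y ∈ ssPid A i x ↔ ⟨i, x⟩ ∈ A ∧ y = x := by
  rw [ssPid, mem_pid]
  simp

lemma isSome_ssPid {A : Finset (Σ i, Fin (m i))} {i : Fin k} {x : Fin (m i)} :
    (ssPid A i x).isSome ↔ ⟨i, x⟩ ∈ A := by
  simp [Option.isSome_iff_exists, ← Option.mem_def, mem_ssPid]

lemma ssPid_univ : ssPid Finset.univ = (ssData k m).one := by
  funext i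
  change _ = PEquiv.refl _
  ext x y
  simp only [← Option.mem_def, mem_ssPid, Finset.mem_univ, true_and]
  exact eq_comm.trans Option.some_inj.symm

lemma ssPid_empty : ssPid ∅ = (ssData k m).zero := by
  funext i
  change _ = (⊥ : PEquiv _ _)
  ext x y
  simp [← Option.mem_def, mem_ssPid]

lemma ssPid_mul (A B : Finset (Σ i, Fin (m i))) :
    (ssData k m).mul (ssPid A) (ssPid B) = ssPid (A ∩ B) := by
  funext i
  change (ssPid B i).trans (ssPid A i) = _
  ext x y
  simp only [← Option.mem_def, PEquiv.mem_trans, mem_ssPid, Finset.mem_inter]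
  aesop

lemma isIdem_ssPid (A : Finset (Σ i, Fin (m i))) : IsIdem (ssData k m) (ssPid A) := by
  rw [IsIdem, ssPid_mul, Finset.inter_self]

lemma compatible_ssPid (A B : Finset (Σ i, Fin (m i))) :
    Compatible (ssData k m) (ssPid A) (ssPid B) := by
  have hinv (C : Finset (Σ i, Fin (m i))) : (ssData k m).inv (ssPid C) = ssPid C := rfl
  rw [Compatible, hinv, hinv, ssPid_mul]
  exact ⟨isIdem_ssPid _, isIdem_ssPid _⟩

lemma isJoin_ssPid (A B : Finset (Σ i, Fin (m i))) :
    IsJoin (ssData k m) (ssPid A) (ssPid B) (ssPid (A ∪ B)) := by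
  rw [isJoin_ssData_iff]
  intro i
  simp only [isJoin_symData_iff, PEquiv.le_def, mem_ssPid, isSome_ssPid, Finset.mem_union]
  exact ⟨fun _ _ h => ⟨.inl h.1, h.2⟩, fun _ _ h => ⟨.inr h.1, h.2⟩, fun _ => id⟩

variable {θ : (∀ i : Fin k, PEquiv (Fin (m i)) (Fin (m i))) → PEquiv (Fin n) (Fin n)}

lemma IsMorphism.exists_mem_isSome (hθ : IsMorphism (ssData k m) (symData n) θ)
    (A : Finset (Σ i, Fin (m i))) (x : Fin n) (hx : (θ (ssPid A) x).isSome) :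
    ∃ a ∈ A, (θ (ssPid {a}) x).isSome := by
  induction A using Finset.induction_on with
  | empty =>
    rw [ssPid_empty, hθ.2.1] at hx
    exact absurd hx Bool.false_ne_true
  | insert a A _ ih =>
    have hj := hθ.2.2.2.1 _ _ _ (compatible_ssPid {a} A) (isJoin_ssPid {a} A)
    rw [Finset.insert_eq] at hx
    rcases (isJoin_symData_iff.1 hj).2.2 x hx with h | h
    · exact ⟨a, Finset.mem_insert_self _ _, h⟩
    · obtain ⟨b, hb, hbx⟩ := ih h
      exact ⟨b, Finset.mem_insert_of_mem hb, hbx⟩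

/-- The domains of the images of the atoms partition `Fin n`. -/
lemma IsMorphism.existsUnique_isSome (hθ : IsMorphism (ssData k m) (symData n) θ) (x : Fin n) :
    ∃! a : Σ i, Fin (m i), (θ (ssPid {a}) x).isSome := by
  obtain ⟨a, -, ha⟩ := hθ.exists_mem_isSome Finset.univ x (by
    rw [ssPid_univ, hθ.1]
    rfl)
  refine ⟨a, ha, fun b hb => ?_⟩
  by_contra hab
  have hidem (c : Σ i, Fin (m i)) : IsIdem (symData n) (θ (ssPid {c})) := by
    rw [IsIdem, ← hθ.2.2.1, isIdem_ssPid]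
  obtain ⟨y, hy⟩ := Option.isSome_iff_exists.1 ha
  obtain ⟨z, hz⟩ := Option.isSome_iff_exists.1 hb
  obtain rfl := eq_of_mem_of_isIdem (hidem a) hy
  obtain rfl := eq_of_mem_of_isIdem (hidem b) hz
  have hmul := hθ.2.2.1 (ssPid {a}) (ssPid {b})
  rw [ssPid_mul, Finset.singleton_inter_of_notMem (by simpa [eq_comm] using hab), ssPid_empty,
    hθ.2.1] at hmul
  have hmem : z ∈ (symData n).mul (θ (ssPid {a})) (θ (ssPid {b})) z :=
    (PEquiv.mem_trans _ _ _ _).2 ⟨z, hz, hy⟩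
  rw [← hmul] at hmem
  exact Option.not_mem_none _ hmem

lemma card_isSome_le_of_isIdem {a b : PEquiv (Fin n) (Fin n)}
    (h : IsIdem (symData n) (a.trans b)) :
    Finset.card {x | (a.trans b x).isSome} ≤ Finset.card {x | (b.trans a x).isSome} := by
  have key : ∀ x ∈ Finset.univ.filter fun x => (a.trans b x).isSome,
      ∃ y, y ∈ a x ∧ x ∈ b y := by
    intro x hx
    obtain ⟨z, hz⟩ := Option.isSome_iff_exists.1 (Finset.mem_filter.1 hx).2
    obtain rfl := eq_of_mem_of_isIdem h hz
    exact (PEquiv.mem_trans _ _ _ _).1 hz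
  choose! y hya hyb using key
  refine Finset.card_le_card_of_injOn y (fun x hx => ?_) (fun x hx x' hx' hxx => ?_)
  · simpa using Option.isSome_of_mem
      ((PEquiv.mem_trans b a _ _).2 ⟨x, hyb x hx, hya x hx⟩)
  · refine a.inj (hya x hx) ?_
    rw [hxx]
    exact hya x' hx'

lemma IsMorphism.card_isSome_le (hθ : IsMorphism (ssData k m) (symData n) θ) (i : Fin k)
    (j l : Fin (m i)) :
    Finset.card {x | (θ (ssPid {⟨i, j⟩}) x).isSome} ≤
      Finset.card {x | (θ (ssPid {⟨i, l⟩}) x).isSome} := by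
  let t (p q : Fin (m i)) : ∀ i : Fin k, PEquiv (Fin (m i)) (Fin (m i)) :=
    Function.update (fun _ => ⊥) i (PEquiv.single p q)
  have ht (p q : Fin (m i)) : (ssData k m).mul (t q p) (t p q) = ssPid {⟨i, p⟩} := by
    funext i'
    change (t p q i').trans (t q p i') = _
    obtain rfl | hi := eq_or_ne i' i
    · ext x y
      simp only [t, Function.update_self, PEquiv.single_trans_single, ← Option.mem_def, mem_ssPid,
        PEquiv.mem_single_iff, Finset.mem_singleton, Sigma.mk.injEq, heq_eq_eq, true_and]
      aesop
    · ext x y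
      simp [t, hi, ← Option.mem_def, mem_ssPid]
  have hθt (p q : Fin (m i)) : (θ (t p q)).trans (θ (t q p)) = θ (ssPid {⟨i, p⟩}) := by
    rw [← ht p q, hθ.2.2.1]
    rfl
  rw [← hθt j l, ← hθt l j]
  apply card_isSome_le_of_isIdem
  rw [hθt, IsIdem, ← hθ.2.2.1, isIdem_ssPid]

end Multiplicity

/-- There is a morphism of Boolean inverse `∧`-monoids from the semisimple inverse monoid
`I_{m 0} × ⋯ × I_{m (k-1)}` to the symmetric inverse monoid `I_n` if, and only if, there
are non-negative integers `s 0, …, s (k-1)` with `s 0 · m 0 + ⋯ + s (k-1) · m (k-1) = n`. -/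
theorem morphism_semisimple_iff (k : ℕ) (m : Fin k → ℕ) (n : ℕ)
    (hm : ∀ i, 1 ≤ m i) (hn : 1 ≤ n) :
    (∃ θ : (∀ i : Fin k, PEquiv (Fin (m i)) (Fin (m i))) → PEquiv (Fin n) (Fin n),
      IsMorphism (ssData k m) (symData n) θ) ↔
    ∃ s : Fin k → ℕ, ∑ i, s i * m i = n := by
  constructor
  · rintro ⟨θ, hθ⟩
    refine ⟨fun i => Finset.card {x | (θ (ssPid {⟨i, ⟨0, hm i⟩⟩}) x).isSome}, ?_⟩
    choose a ha hau using hθ.existsUnique_isSome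
    have hfiber (b : Σ i, Fin (m i)) :
        Finset.univ.filter (fun x => a x = b) =
          Finset.univ.filter fun x => (θ (ssPid {b}) x).isSome := by
      ext x
      simp only [Finset.mem_filter, Finset.mem_univ, true_and]
      exact ⟨fun h => h ▸ ha x, fun h => (hau x b h).symm⟩
    calc ∑ i, Finset.card {x | (θ (ssPid {⟨i, ⟨0, hm i⟩⟩}) x).isSome} * m i
        = ∑ i, ∑ j : Fin (m i), Finset.card {x | (θ (ssPid {⟨i, j⟩}) x).isSome} := by
          refine Finset.sum_congr rfl fun i _ => ?_
          rw [Finset.sum_congr rfl fun j _ => le_antisymm (hθ.card_isSome_le i j ⟨0, hm i⟩)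
            (hθ.card_isSome_le i ⟨0, hm i⟩ j)]
          simp [mul_comm]
      _ = ∑ b : Σ i, Fin (m i), Finset.card {x | a x = b} := by
          simp only [hfiber, Fintype.sum_sigma]
      _ = n := by
          rw [← Finset.card_eq_sum_card_fiberwise fun x _ => Finset.mem_coe.2 (Finset.mem_univ _)]
          simp
  · rintro ⟨s, hs⟩
    have e : (Σ i, Fin (s i) × Fin (m i)) ≃ Fin n := Fintype.equivFinOfCardEq (by simpa using hs)
    exact ⟨copiesMap e, isMorphism_copiesMap e⟩

end Coordinatization
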